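/- Let d ≥ 1, let U_1 and U_2 be d×d complex unitary matrices, let b_1 and b_2 be unit vectors in ℂ^d, and define the snapshot matrices ρ̂_i = (d+1) U_i† |b_i⟩⟨b_i| U_i − I for i = 1, 2. Let S be the swap operator on ℂ^d ⊗ ℂ^d determined by S(u ⊗ v) = v ⊗ u. Then tr(S · (ρ̂_1 ⊗ ρ̂_2)) = (d+1)² |⟨b_1, U_1 U_2† b_2⟩|² − 2(d+1) + d. -/

import Mathlib

open Matrix
open scoped Kronecker

/-- The swap trick: the trace of the swap operator times `A ⊗ B` is the trace of `A * B`. -/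
theorem trace_swap_mul_kronecker {n R : Type*} [Fintype n] [DecidableEq n] [CommSemiring R]
    (S : Matrix (n × n) (n × n) R)
    (hS : ∀ p q : n × n, S p q = if p.1 = q.2 ∧ p.2 = q.1 then 1 else 0)
    (A B : Matrix n n R) :
    trace (S * (A ⊗ₖ B)) = trace (A * B) := by
  have hrow (p : n × n) : (S * (A ⊗ₖ B)) p p = A p.2 p.1 * B p.1 p.2 := by
    rw [Matrix.mul_apply, Finset.sum_eq_single p.swap]
    · simp [hS]
    · rintro ⟨i, j⟩ - hq
      rw [hS, if_neg, zero_mul]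
      rintro ⟨h₁, h₂⟩
      exact hq (Prod.ext h₂.symm h₁.symm)
    · simp
  simp only [trace, diag_apply, hrow, Matrix.mul_apply, Fintype.sum_prod_type]
  exact Finset.sum_comm

theorem conjTranspose_mul_vecMulVec_star_mul {m n R : Type*} [Fintype m]
    [CommSemiring R] [StarRing R] (U : Matrix m n R) (b : m → R) :
    Uᴴ * vecMulVec b (star b) * U = vecMulVec (Uᴴ *ᵥ b) (star (Uᴴ *ᵥ b)) := by
  rw [mul_vecMulVec, vecMulVec_mul, star_mulVec, conjTranspose_conjTranspose]

theorem star_dotProduct_conjTranspose_mulVec {l m n R : Type*} [Fintype l] [Fintype m] [Fintype n]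
    [CommSemiring R] [StarRing R] (U : Matrix l n R) (V : Matrix m n R) (b : l → R) (c : m → R) :
    star (Uᴴ *ᵥ b) ⬝ᵥ (Vᴴ *ᵥ c) = star b ⬝ᵥ (U * Vᴴ) *ᵥ c := by
  rw [star_mulVec, conjTranspose_conjTranspose, ← dotProduct_mulVec, mulVec_mulVec]

theorem star_dotProduct_self_eq_sum_normSq {n : Type*} [Fintype n] (v : n → ℂ) :
    star v ⬝ᵥ v = ((∑ i, Complex.normSq (v i) : ℝ) : ℂ) := by
  simp [dotProduct, Complex.normSq_eq_conj_mul_self]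

theorem trace_vecMulVec_star_mul_vecMulVec_star {n : Type*} [Fintype n] (v w : n → ℂ) :
    trace (vecMulVec v (star v) * vecMulVec w (star w)) = Complex.normSq (star v ⬝ᵥ w) := by
  have h : v ⬝ᵥ star w = star (star v ⬝ᵥ w) := by
    rw [dotProduct_comm, star_dotProduct]
  rw [vecMulVec_mul_vecMulVec, trace_vecMulVec, dotProduct_smul, h, smul_eq_mul]
  exact Complex.mul_conj _

/-- A unitary conjugate of a rank-one projector has trace one. -/
theorem trace_vecMulVec_conjTranspose_mulVec {n : Type*} [Fintype n] [DecidableEq n]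
    {U : Matrix n n ℂ} (hU : U ∈ unitaryGroup n ℂ) {b : n → ℂ}
    (hb : ∑ i, Complex.normSq (b i) = 1) :
    trace (vecMulVec (Uᴴ *ᵥ b) (star (Uᴴ *ᵥ b))) = 1 := by
  have h : U * Uᴴ = 1 := mem_unitaryGroup_iff.mp hU
  rw [trace_vecMulVec, dotProduct_comm, star_dotProduct_conjTranspose_mulVec, h, one_mulVec,
    star_dotProduct_self_eq_sum_normSq, hb, Complex.ofReal_one]

/-- Purity estimate from a pair of classical snapshots: for unitaries `U₁, U₂`, unit vectors
`b₁, b₂ ∈ ℂ^d`, snapshots `ρ̂ᵢ = (d+1) Uᵢ† |bᵢ⟩⟨bᵢ| Uᵢ − I`, and the swap operator `S`,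
`tr(S (ρ̂₁ ⊗ ρ̂₂)) = (d+1)² |⟨b₁, U₁U₂† b₂⟩|² − 2(d+1) + d`. -/
theorem snapshot_purity {d : ℕ} (hd : 1 ≤ d)
    (U₁ U₂ : Matrix (Fin d) (Fin d) ℂ)
    (hU₁ : U₁ ∈ Matrix.unitaryGroup (Fin d) ℂ) (hU₂ : U₂ ∈ Matrix.unitaryGroup (Fin d) ℂ)
    (b₁ b₂ : Fin d → ℂ)
    (hb₁ : ∑ i, Complex.normSq (b₁ i) = 1) (hb₂ : ∑ i, Complex.normSq (b₂ i) = 1)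
    (S : Matrix (Fin d × Fin d) (Fin d × Fin d) ℂ)
    (hS : ∀ p q : Fin d × Fin d, S p q = if p.1 = q.2 ∧ p.2 = q.1 then 1 else 0) :
    Matrix.trace (S *
        ((((d : ℂ) + 1) • (U₁ᴴ * Matrix.vecMulVec b₁ (star b₁) * U₁) - 1) ⊗ₖ
          (((d : ℂ) + 1) • (U₂ᴴ * Matrix.vecMulVec b₂ (star b₂) * U₂) - 1)))
      = ((d : ℂ) + 1) ^ 2 * (Complex.normSq (star b₁ ⬝ᵥ (U₁ * U₂ᴴ).mulVec b₂) : ℂ)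
        - 2 * ((d : ℂ) + 1) + d := by
  rw [trace_swap_mul_kronecker S hS, conjTranspose_mul_vecMulVec_star_mul,
    conjTranspose_mul_vecMulVec_star_mul, ← star_dotProduct_conjTranspose_mulVec]
  simp only [sub_mul, mul_sub, one_mul, mul_one, smul_mul_assoc, mul_smul_comm, trace_sub,
    trace_smul, trace_one, Fintype.card_fin, smul_eq_mul, trace_vecMulVec_star_mul_vecMulVec_star,
    trace_vecMulVec_conjTranspose_mulVec hU₁ hb₁, trace_vecMulVec_conjTranspose_mulVec hU₂ hb₂]
  ring
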